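/- Let F be a field with a fixed algebraic closure F̄, let A be a reduced finitely generated commutative F-algebra, and let G be a finite group acting on A by F-algebra automorphisms such that the induced action of G on Hom_{F-alg}(A, F̄) is free. Let M be any module over A^G, and let G act on A ⊗_{A^G} M through its action on the left factor A. Then the natural map M → (A ⊗_{A^G} M)^G, m ↦ 1 ⊗ m, is an isomorphism of A^G-modules onto the submodule of G-invariant elements. -/

import Mathlib

open scoped TensorProduct

/-- The subalgebra of invariants of a group acting by `F`-algebra automorphisms. -/
def invariantSubalgebra (F A : Type*) [CommSemiring F] [CommSemiring A] [Algebra F A]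
    {G : Type*} [Group G] (ρ : G →* (A ≃ₐ[F] A)) : Subalgebra F A where
  carrier := {a | ∀ g : G, ρ g a = a}
  mul_mem' := fun {a b} ha hb g => by simp only [map_mul, ha g, hb g]
  add_mem' := fun {a b} ha hb g => by simp only [map_add, ha g, hb g]
  algebraMap_mem' := fun c g => by simp

/-- The action of a group element `g` on `A`, viewed as an algebra homomorphism over
the invariant subalgebra `A^G` (it fixes `A^G` pointwise). -/
def invariantsAlgHom (F A : Type*) [CommSemiring F] [CommSemiring A] [Algebra F A]
    {G : Type*} [Group G] (ρ : G →* (A ≃ₐ[F] A)) (g : G) :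
    A →ₐ[invariantSubalgebra F A ρ] A where
  toFun := ρ g
  map_one' := map_one _
  map_mul' := map_mul _
  map_zero' := map_zero _
  map_add' := map_add _
  commutes' := fun b => b.2 g

section FreeAction

variable {F A G : Type*}

section Trace

variable [CommRing F] [CommRing A] [Algebra F A] [Group G] (ρ : G →* (A ≃ₐ[F] A))

/-- The ring of a finite group action is integral over its invariants. -/
theorem isIntegral_invariantSubalgebra [Finite G] :
    Algebra.IsIntegral (invariantSubalgebra F A ρ) A := by
  let : MulSemiringAction G A := MulSemiringAction.compHom A ρ
  have : Algebra.IsInvariant (invariantSubalgebra F A ρ) A G :=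
    ⟨fun b hb => ⟨⟨b, hb⟩, rfl⟩⟩
  exact Algebra.IsInvariant.isIntegral (invariantSubalgebra F A ρ) A G

@[simp]
theorem invariantsAlgHom_apply (g : G) (a : A) : invariantsAlgHom F A ρ g a = ρ g a := rfl

/-- The algebra homomorphism `a ⊗ b ↦ a * g b`. -/
def twistedMul (g : G) :
    A ⊗[invariantSubalgebra F A ρ] A →ₐ[invariantSubalgebra F A ρ] A :=
  Algebra.TensorProduct.lift (AlgHom.id _ A) (invariantsAlgHom F A ρ g)
    fun _ _ => Commute.all _ _

@[simp]
theorem twistedMul_tmul (g : G) (a b : A) : twistedMul ρ g (a ⊗ₜ b) = a * ρ g b :=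
  Algebra.TensorProduct.lift_tmul _ _ _ _ _

theorem map_invariantsAlgHom_smul {M : Type*} [AddCommGroup M]
    [Module (invariantSubalgebra F A ρ) M] (g : G) (a : A) (x : A ⊗[invariantSubalgebra F A ρ] M) :
    TensorProduct.map (invariantsAlgHom F A ρ g).toLinearMap LinearMap.id (a • x) =
      ρ g a • TensorProduct.map (invariantsAlgHom F A ρ g).toLinearMap LinearMap.id x := by
  induction x with
  | zero => simp
  | add x y hx hy => simp only [smul_add, map_add, hx, hy]
  | tmul b m => simp [TensorProduct.smul_tmul']

variable [Fintype G]

/-- The trace `a ↦ ∑ g, g a`, as a linear map to the invariants. -/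
def invariantTrace : A →ₗ[invariantSubalgebra F A ρ] invariantSubalgebra F A ρ where
  toFun a := ⟨∑ g, ρ g a, fun h => by
    rw [map_sum]
    exact Fintype.sum_equiv (Equiv.mulLeft h) _ _ fun g => by simp⟩
  map_add' a b := Subtype.ext <| by simp [Finset.sum_add_distrib]
  map_smul' r a := Subtype.ext <| by
    have h (g : G) : ρ g (r • a) = r • ρ g a :=
      (invariantsAlgHom F A ρ g).toLinearMap.map_smul r a
    simp only [h, ← Finset.smul_sum]
    rfl

@[simp]
theorem coe_invariantTrace (a : A) : (invariantTrace ρ a : A) = ∑ g, ρ g a := rfl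

/-- If the ideals generated by the differences `b - g b`, for `g ≠ 1`, are all trivial, there is
an element of `A ⊗ A` that separates `1` from the other group elements. -/
theorem exists_twistedMul_eq_ite [DecidableEq G]
    (h : ∀ g : G, g ≠ 1 → Ideal.span (Set.range fun b : A => b - ρ g b) = ⊤) :
    ∃ e, ∀ g, twistedMul ρ g e = if g = 1 then 1 else 0 := by
  have hsep (g : G) (hg : g ≠ 1) : ∃ e, twistedMul ρ g e = 0 ∧ twistedMul ρ 1 e = 1 := by
    have hsurj : Function.Surjective (twistedMul ρ 1) := fun a => ⟨a ⊗ₜ 1, by simp⟩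
    have htop : Ideal.map (twistedMul ρ 1) (RingHom.ker (twistedMul ρ g)) = ⊤ := by
      rw [eq_top_iff, ← h g hg, Ideal.span_le]
      rintro _ ⟨b, rfl⟩
      refine (Ideal.mem_map_iff_of_surjective _ hsurj).2 ⟨1 ⊗ₜ b - ρ g b ⊗ₜ 1, ?_, ?_⟩ <;>
        simp [RingHom.mem_ker]
    exact (Ideal.mem_map_iff_of_surjective _ hsurj).1 (htop ▸ Submodule.mem_top)
  choose! e he he' using hsep
  refine ⟨∏ g ∈ Finset.univ.erase 1, e g, fun g => ?_⟩
  rw [map_prod]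
  split_ifs with hg
  · subst hg
    exact Finset.prod_eq_one fun g hg => he' g (Finset.ne_of_mem_erase hg)
  · exact Finset.prod_eq_zero (Finset.mem_erase.2 ⟨hg, Finset.mem_univ g⟩) (he g hg)

theorem exists_invariantTrace_eq_one
    (h : ∀ g : G, g ≠ 1 → Ideal.span (Set.range fun b : A => b - ρ g b) = ⊤) :
    ∃ c, invariantTrace ρ c = 1 := by
  classical
  obtain ⟨e, he⟩ := exists_twistedMul_eq_ite ρ h
  set I : Ideal (invariantSubalgebra F A ρ) := LinearMap.range (invariantTrace ρ) with hI
  have hmem (x : A ⊗[invariantSubalgebra F A ρ] A) :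
      ∑ g, twistedMul ρ g x ∈ I.map (algebraMap (invariantSubalgebra F A ρ) A) := by
    induction x with
    | zero => simp
    | add x y hx hy => simpa [Finset.sum_add_distrib] using add_mem hx hy
    | tmul a b =>
      simp only [twistedMul_tmul, ← Finset.mul_sum]
      exact Ideal.mul_mem_left _ a
        (Ideal.mem_map_of_mem (algebraMap (invariantSubalgebra F A ρ) A)
          (LinearMap.mem_range_self (invariantTrace ρ) b))
  have hone := hmem e
  simp only [he, Finset.sum_ite_eq', Finset.mem_univ, if_true] at hone
  have := isIntegral_invariantSubalgebra ρ
  have htop : I = ⊤ :=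
    (Ideal.map_eq_top_iff _ Subtype.val_injective
      (algebraMap_isIntegral_iff.2 inferInstance)).1 ((Ideal.eq_top_iff_one _).2 hone)
  exact LinearMap.mem_range.1 (hI ▸ htop ▸ Submodule.mem_top)

theorem sum_map_invariantsAlgHom {M : Type*} [AddCommGroup M]
    [Module (invariantSubalgebra F A ρ) M] (x : A ⊗[invariantSubalgebra F A ρ] M) :
    ∑ g, TensorProduct.map (invariantsAlgHom F A ρ g).toLinearMap LinearMap.id x =
      1 ⊗ₜ TensorProduct.lid _ M ((invariantTrace ρ).rTensor M x) := by
  induction x with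
  | zero => simp
  | add x y hx hy => simp only [map_add, Finset.sum_add_distrib, hx, hy, TensorProduct.tmul_add]
  | tmul a m =>
    simp only [TensorProduct.map_tmul, ← TensorProduct.sum_tmul, LinearMap.rTensor_tmul,
      TensorProduct.lid_tmul, ← TensorProduct.smul_tmul, LinearMap.id_apply]
    congr 1
    simp [Subalgebra.smul_def]

end Trace

/-- If an automorphism `σ` fixes no geometric point, the ideal of its fixed locus is trivial. -/
theorem span_sub_eq_top_of_comp_ne [Field F] [CommRing A] [Algebra F A] [Algebra.FiniteType F A]
    (σ : A ≃ₐ[F] A)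
    (h : ∀ φ : A →ₐ[F] AlgebraicClosure F, φ.comp σ.toAlgHom ≠ φ) :
    Ideal.span (Set.range fun b : A => b - σ b) = ⊤ := by
  by_contra hne
  obtain ⟨m, hm, hle⟩ := Ideal.exists_le_maximal _ hne
  let : Field (A ⧸ m) := Ideal.Quotient.field m
  have : Module.Finite F (A ⧸ m) := finite_of_finite_type_of_isJacobsonRing F (A ⧸ m)
  let ψ : A ⧸ m →ₐ[F] AlgebraicClosure F := IsAlgClosed.lift
  refine h (ψ.comp (Ideal.Quotient.mkₐ F m)) (AlgHom.ext fun b => congrArg ψ ?_)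
  exact (Ideal.Quotient.eq.2 (hle (Ideal.subset_span ⟨b, rfl⟩))).symm

end FreeAction

/-- Let `F` be a field with algebraic closure `F̄`, let `A` be a reduced finitely
generated commutative `F`-algebra with a free action (on `F̄`-points) of a finite group
`G` by `F`-algebra automorphisms, and let `M` be a module over `A^G`.  Letting `G` act
on `A ⊗_{A^G} M` through the left factor, the natural map `M → (A ⊗_{A^G} M)^G`,
`m ↦ 1 ⊗ m`, is an isomorphism of `A^G`-modules onto the submodule of `G`-invariants:
it is injective and its range is exactly the set of `G`-invariant elements. -/
theorem invariants_of_tensor_of_free_action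
    (F : Type*) [Field F] (A : Type*) [CommRing A] [IsReduced A] [Algebra F A]
    [Algebra.FiniteType F A]
    (G : Type*) [Group G] [Finite G] (ρ : G →* (A ≃ₐ[F] A))
    (hfree : ∀ (g : G) (φ : A →ₐ[F] AlgebraicClosure F),
      φ.comp (ρ g).toAlgHom = φ → g = 1)
    (M : Type*) [AddCommGroup M] [Module (invariantSubalgebra F A ρ) M] :
    Function.Injective (TensorProduct.mk (invariantSubalgebra F A ρ) A M 1) ∧
    Set.range (TensorProduct.mk (invariantSubalgebra F A ρ) A M 1) =
      {x : A ⊗[invariantSubalgebra F A ρ] M | ∀ g : G,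
        TensorProduct.map (invariantsAlgHom F A ρ g).toLinearMap LinearMap.id x = x} := by
  classical
  have := Fintype.ofFinite G
  obtain ⟨c, hc⟩ := exists_invariantTrace_eq_one ρ fun g hg =>
    span_sub_eq_top_of_comp_ne (ρ g) fun φ hφ => hg (hfree g φ hφ)
  refine ⟨fun m n hmn => ?_, Set.Subset.antisymm ?_ fun x hx => ?_⟩
  · have h (m : M) :
        TensorProduct.lid _ M ((invariantTrace ρ).rTensor M (c • (1 : A) ⊗ₜ m)) = m := by
      simp [TensorProduct.smul_tmul', hc]
    rw [← h m, ← h n]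
    exact congrArg (fun x => TensorProduct.lid _ M ((invariantTrace ρ).rTensor M (c • x))) hmn
  · rintro _ ⟨m, rfl⟩ g
    simp
  · refine ⟨_, (sum_map_invariantsAlgHom ρ (c • x)).symm.trans ?_⟩
    simp only [map_invariantsAlgHom_smul, hx _, ← Finset.sum_smul]
    rw [← coe_invariantTrace, hc, OneMemClass.coe_one, one_smul]
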